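/- arXiv:1410.4116 — 2 statements merged into one kernel-verified Lean document; each statement's English description precedes it below -/
import Mathlib

section
/- Let n ≥ 2 and 0 ≤ ℓ ≤ n. Let {φ_j}_{j=1}^{n-1} and {ψ_j}_{j=1}^{n-1} be two families of holomorphic polynomials on ℂⁿ, and let B(z, ξ) be a polynomial in the 2n variables (z, ξ). If ∑_{j=1}^{n-1} φ_j(z) ψ_j(ξ) = B(z, ξ)·⟨z, ξ⟩_ℓ identically, then B = 0 and ∑_{j=1}^{n-1} φ_j(z) ψ_j(ξ) = 0 identically. -/
open MvPolynomial

/-- The complexified pairing `⟨z, ξ⟩_ℓ = -∑_{j<ℓ} z_j ξ_j + ∑_{j≥ℓ} z_j ξ_j`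
as a polynomial in the `2n` variables `(z, ξ)`. -/
noncomputable def pairingPoly (n ℓ : ℕ) : MvPolynomial (Fin n ⊕ Fin n) ℂ :=
  ∑ j : Fin n, (if (j : ℕ) < ℓ then (-1 : MvPolynomial (Fin n ⊕ Fin n) ℂ) else 1) *
    X (Sum.inl j) * X (Sum.inr j)

/-- The sign of the `a`-th coordinate. -/
noncomputable def sgnC (n ℓ : ℕ) (a : Fin n) : ℂ := if (a : ℕ) < ℓ then -1 else 1

theorem sgnC_mul_self (n ℓ : ℕ) (a : Fin n) : sgnC n ℓ a * sgnC n ℓ a = 1 := by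
  unfold sgnC; split_ifs <;> norm_num

theorem eval_pairingPoly (n ℓ : ℕ) (x : Fin n ⊕ Fin n → ℂ) :
    eval x (pairingPoly n ℓ) = ∑ j, sgnC n ℓ j * x (Sum.inl j) * x (Sum.inr j) := by
  unfold pairingPoly sgnC
  simp only [map_sum, map_mul, eval_X]
  refine Finset.sum_congr rfl fun j _ => ?_
  split_ifs <;> simp

theorem pairingPoly_ne_zero (n ℓ : ℕ) (hn : 2 ≤ n) : pairingPoly n ℓ ≠ 0 := by
  intro h
  have h1 := eval_pairingPoly n ℓ (fun s => Sum.elim (Pi.single (⟨0, by omega⟩ : Fin n) (1 : ℂ))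
    (Pi.single (⟨0, by omega⟩ : Fin n) (1 : ℂ)) s)
  rw [h] at h1
  simp [Pi.single_apply, sgnC] at h1
  split_ifs at h1 <;> norm_num at h1

theorem exists_eval_ne_zero {σ : Type*} (p : MvPolynomial σ ℂ) (hp : p ≠ 0) :
    ∃ x, eval x p ≠ 0 := by
  by_contra! h
  exact hp (MvPolynomial.funext (fun x => by simp [h x]))

/-- Any pair `(z, y)` with `z ⬝ y ≠ 0`, `y i ≠ 0` is a row of a matrix and a multiple of the
corresponding column of its adjugate. -/
theorem exists_matrix (n : ℕ) (i : Fin n) (z y : Fin n → ℂ) (hzy : ∑ a, z a * y a ≠ 0)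
    (hy : y i ≠ 0) : ∃ (Z : Matrix (Fin n) (Fin n) ℂ) (t : ℂ), Z i = z ∧
      ∀ a, t * Z.adjugate a i = y a := by
  let Z : Matrix (Fin n) (Fin n) ℂ := fun j =>
    if j = i then z else Pi.single j (y i) - Pi.single i (y j)
  have hZi : Z i = z := by simp [Z]
  have hmul : ∀ v j, j ≠ i → (Z.mulVec v) j = y i * v j - y j * v i := by
    intro v j hj
    have hZj : Z j = Pi.single j (y i) - Pi.single i (y j) := by
      simp only [Z, if_neg hj]
    change dotProduct (Z j) v = _
    rw [hZj, sub_dotProduct, single_dotProduct, single_dotProduct]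
  have hmuli : ∀ v, (Z.mulVec v) i = ∑ a, z a * v a := by
    intro v
    simp [Matrix.mulVec, hZi, dotProduct]
  have hdet : Z.det ≠ 0 := by
    intro h0
    obtain ⟨v, hv, hv0⟩ := Matrix.exists_mulVec_eq_zero_iff.mpr h0
    have hvj : ∀ j, v j = v i / y i * y j := by
      intro j
      by_cases hj : j = i
      · subst hj; field_simp
      · have := hmul v j hj
        rw [hv0] at this
        simp only [Pi.zero_apply] at this
        field_simp
        linear_combination -this
    have h2 := hmuli v
    rw [hv0, Finset.sum_congr rfl (fun a _ => by
      rw [hvj a, mul_left_comm])] at h2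
    rw [← Finset.mul_sum] at h2
    have h3 : v i / y i = 0 := by
      rcases mul_eq_zero.mp h2.symm with h | h
      · exact h
      · exact absurd h hzy
    apply hv
    ext j
    rw [hvj j, h3]; simp
  have hZy : Z.mulVec y = Pi.single i (∑ a, z a * y a) := by
    ext j
    by_cases hj : j = i
    · subst hj; simp [hmuli]
    · rw [hmul y j hj]; simp [hj]; ring
  refine ⟨Z, Z.det⁻¹ * ∑ a, z a * y a, hZi, fun a => ?_⟩
  have h4 : Z.adjugate.mulVec (Z.mulVec y) = Z.det • y := by
    rw [Matrix.mulVec_mulVec, Matrix.adjugate_mul, Matrix.smul_mulVec, Matrix.one_mulVec]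
  rw [hZy] at h4
  have h5 := congrFun h4 a
  simp only [Matrix.mulVec_single, Pi.smul_apply, smul_eq_mul, MulOpposite.smul_eq_mul_unop,
    MulOpposite.unop_op, Matrix.col_apply] at h5
  field_simp
  linear_combination h5

theorem sum_eq_zero_aux (n ℓ : ℕ) (hn : 2 ≤ n)
    (φ ψ : Fin (n - 1) → MvPolynomial (Fin n) ℂ)
    (A B : MvPolynomial (Fin n ⊕ Fin n) ℂ)
    (hA : (∑ j : Fin (n - 1),
        MvPolynomial.rename Sum.inl (φ j) * MvPolynomial.rename Sum.inr (ψ j)) = A)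
    (hAB : A = B * pairingPoly n ℓ) : A = 0 := by
  by_contra hne
  let M : Matrix (Fin n) (Fin n) (MvPolynomial (Option (Fin n × Fin n)) ℂ) :=
    Matrix.of fun a b => X (some (a, b))
  let g : Fin n → Fin n ⊕ Fin n → MvPolynomial (Option (Fin n × Fin n)) ℂ := fun i =>
    Sum.elim (fun a => M i a) (fun a => C (sgnC n ℓ a) * (X none * M.adjugate a i))
  -- evaluation of the substitution
  have hadj : ∀ (x : Option (Fin n × Fin n) → ℂ) (a i : Fin n), eval x (M.adjugate a i) =
      (Matrix.of fun a b => x (some (a, b)) : Matrix (Fin n) (Fin n) ℂ).adjugate a i := by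
    intro x a i
    have h := RingHom.map_adjugate (eval x) M
    have hentry := congrFun (congrFun h a) i
    simp only [RingHom.mapMatrix_apply, Matrix.map_apply] at hentry
    rw [hentry]
    have hM : M.map (eval x) = Matrix.of fun a b => x (some (a, b)) := by
      ext a b
      simp [M]
    rw [hM]
  have hev : ∀ (x : Option (Fin n × Fin n) → ℂ) i (p : MvPolynomial (Fin n ⊕ Fin n) ℂ),
      eval x (bind₁ (g i) p) = eval (Sum.elim (fun a => x (some (i, a)))
        (fun a => sgnC n ℓ a * (x none *
      (Matrix.of fun a b => x (some (a, b)) : Matrix (Fin n) (Fin n) ℂ).adjugate a i))) p := by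
    intro x i p
    have h : eval x (bind₁ (g i) p) = eval (fun s => eval x (g i s)) p :=
      eval₂Hom_bind₁ (RingHom.id ℂ) x (g i) p
    rw [h]
    congr 2
    ext s
    rcases s with a | a
    · simp [g, M]
    · simp [g, hadj]
  have hP : ∀ i, bind₁ (g i) A ≠ 0 := by
    intro i h0
    obtain ⟨x, hx⟩ := exists_eval_ne_zero (A * X (Sum.inr i)) (mul_ne_zero hne (X_ne_zero _))
    rw [map_mul, eval_X] at hx
    have hxA := left_ne_zero_of_mul hx
    have hxi := right_ne_zero_of_mul hx
    have hp : eval x (pairingPoly n ℓ) ≠ 0 := by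
      rw [hAB, map_mul] at hxA
      exact right_ne_zero_of_mul hxA
    rw [eval_pairingPoly] at hp
    have hs : ∀ a, sgnC n ℓ a ≠ 0 := fun a => left_ne_zero_of_mul_eq_one (sgnC_mul_self n ℓ a)
    obtain ⟨Z, t, hZ, ht⟩ := exists_matrix n i (fun a => x (Sum.inl a))
      (fun a => sgnC n ℓ a * x (Sum.inr a))
      (by
        convert hp using 2
        ring) (mul_ne_zero (hs i) hxi)
    have h1 := hev (fun o => o.elim t (fun p => Z p.1 p.2)) i A
    rw [h0, map_zero] at h1
    apply hxA
    rw [h1]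
    congr 2
    ext s
    rcases s with a | a
    · simp [hZ]
    · have h2 := ht a
      have h3 : (Matrix.of fun a b => Z a b) = Z := rfl
      simp only [Option.elim, Sum.elim_inr, h3]
      rw [h2, ← mul_assoc, sgnC_mul_self, one_mul]
  obtain ⟨x, hx⟩ := exists_eval_ne_zero (∏ i, bind₁ (g i) A)
    (Finset.prod_ne_zero_iff.mpr fun i _ => hP i)
  rw [map_prod, Finset.prod_ne_zero_iff] at hx
  let Z : Matrix (Fin n) (Fin n) ℂ := Matrix.of fun a b => x (some (a, b))
  let w : Fin n → Fin n → ℂ := fun k a => sgnC n ℓ a * (x none * Z.adjugate a k)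
  let N : Matrix (Fin n) (Fin n) ℂ := fun j k => eval (Sum.elim (Z j) (w k)) A
  have hdiag : N = Matrix.diagonal fun i => N i i := by
    ext j k
    by_cases hjk : j = k
    · subst hjk; simp
    · rw [Matrix.diagonal_apply_ne _ hjk]
      simp only [N]
      rw [hAB, map_mul, eval_pairingPoly]
      have h1 : (Z * Z.adjugate) j k = 0 := by
        rw [Matrix.mul_adjugate]; simp [hjk]
      rw [Matrix.mul_apply] at h1
      have h2 : ∑ a, sgnC n ℓ a * Z j a * w k a = x none * ∑ a, Z j a * Z.adjugate a k := by
        rw [Finset.mul_sum]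
        refine Finset.sum_congr rfl fun a _ => ?_
        simp only [w]
        linear_combination (Z j a * x none * Z.adjugate a k) * sgnC_mul_self n ℓ a
      simp only [Sum.elim_inl, Sum.elim_inr]
      rw [h2, h1]; simp
  have hNdet : N.det ≠ 0 := by
    rw [hdiag, Matrix.det_diagonal, Finset.prod_ne_zero_iff]
    intro i _
    have := hx i (Finset.mem_univ i)
    rw [hev] at this
    exact this
  have hfac : N = (Matrix.of fun j m => eval (Z j) (φ m) : Matrix (Fin n) (Fin (n-1)) ℂ) *
      (Matrix.of fun m k => eval (w k) (ψ m) : Matrix (Fin (n-1)) (Fin n) ℂ) := by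
    ext j k
    simp only [N, ← hA, Matrix.mul_apply, map_sum, map_mul, eval_rename, Matrix.of_apply]
    rfl
  have hr : N.rank = n := by
    rw [Matrix.rank_of_isUnit N ((Matrix.isUnit_iff_isUnit_det N).mpr hNdet.isUnit)]
    simp
  have hr2 : N.rank ≤ n - 1 := by
    rw [hfac]
    refine (Matrix.rank_mul_le_left _ _).trans ?_
    simpa using Matrix.rank_le_card_width
      (Matrix.of fun j m => eval (Z j) (φ m) : Matrix (Fin n) (Fin (n-1)) ℂ)
  omega

theorem huang_lemma_polynomial (n ℓ : ℕ) (hn : 2 ≤ n) (hℓ : ℓ ≤ n)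
    (φ ψ : Fin (n - 1) → MvPolynomial (Fin n) ℂ)
    (B : MvPolynomial (Fin n ⊕ Fin n) ℂ)
    (heq : (∑ j : Fin (n - 1),
        MvPolynomial.rename Sum.inl (φ j) * MvPolynomial.rename Sum.inr (ψ j)) =
      B * pairingPoly n ℓ) :
    B = 0 ∧
    (∑ j : Fin (n - 1),
        MvPolynomial.rename Sum.inl (φ j) * MvPolynomial.rename Sum.inr (ψ j)) = 0 := by
  have h0 := sum_eq_zero_aux n ℓ hn φ ψ _ B rfl heq
  refine ⟨?_, h0⟩
  rw [h0] at heq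
  rcases mul_eq_zero.mp heq.symm with h | h
  · exact h
  · exact absurd h (pairingPoly_ne_zero n ℓ hn)
end

section
/- Let n ≥ 2, 0 ≤ ℓ ≤ n, and let m ≥ 1 be an integer. Let {φ_j}_{j=1}^{n-1} and {ψ_j}_{j=1}^{n-1} be two families of holomorphic polynomials on ℂⁿ, and let B(z, ξ) be a polynomial in the 2n variables (z, ξ). If ∑_{j=1}^{n-1} φ_j(z) ψ_j(ξ) = B(z, ξ)·⟨z, ξ⟩_ℓ^m identically, then B = 0 and ∑_{j=1}^{n-1} φ_j(z) ψ_j(ξ) = 0 identically. -/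
open MvPolynomial

/-- The sign `-1` for `j < ℓ`, and `1` otherwise. -/
noncomputable def pairSign (R : Type*) [CommRing R] (ℓ : ℕ) (j : ℕ) : R :=
  if j < ℓ then -1 else 1

theorem pairSign_sq (R : Type*) [CommRing R] (ℓ j : ℕ) :
    pairSign R ℓ j * pairSign R ℓ j = 1 := by
  unfold pairSign; split_ifs <;> simp

theorem aeval_pairingPoly {R : Type*} [CommRing R] [Algebra ℂ R] (n ℓ : ℕ) (z w : Fin n → R) :
    aeval (Sum.elim z w) (pairingPoly n ℓ) = ∑ j : Fin n, pairSign R ℓ j * z j * w j := by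
  unfold pairingPoly pairSign
  rw [map_sum]
  refine Finset.sum_congr rfl fun j _ => ?_
  split_ifs <;> simp

/-- A sum of `k` products gives a singular matrix of size `k + 1`. -/
theorem det_low_rank {R : Type*} [CommRing R] (k : ℕ) (p q : Fin k → Fin (k + 1) → R) :
    (Matrix.of fun i j : Fin (k + 1) => ∑ a : Fin k, p a i * q a j).det = 0 := by
  have h : (Matrix.of fun i j : Fin (k + 1) => ∑ a : Fin k, p a i * q a j) =
      (Matrix.of fun i a : Fin (k + 1) => (Fin.cons 0 (fun a => p a i) : Fin (k + 1) → R) a) *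
      (Matrix.of fun a j : Fin (k + 1) => (Fin.cons 0 (fun a => q a j) : Fin (k + 1) → R) a) := by
    ext i j
    simp [Matrix.mul_apply, Fin.sum_univ_succ]
  rw [h, Matrix.det_mul, Matrix.det_eq_zero_of_column_eq_zero 0 (fun i => by simp), zero_mul]

/-- Completing a dual pair `(z, η)` to a matrix and its (scaled) adjugate. -/
theorem exists_dual_matrix (n : ℕ) (i : Fin n) (z η : Fin n → ℂ) (hη : η i ≠ 0)
    (hc : ∑ j, z j * η j ≠ 0) :
    ∃ (A : Matrix (Fin n) (Fin n) ℂ) (t : ℂ), A i = z ∧ ∀ j, t * A.adjugate j i = η j := by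
  classical
  let A : Matrix (Fin n) (Fin n) ℂ := Matrix.of fun k =>
    if k = i then z else fun j => η i * (if j = k then 1 else 0) - η k * (if j = i then 1 else 0)
  have hAi : A i = z := if_pos rfl
  have hAk : ∀ k, k ≠ i → ∀ v, A.mulVec v k = η i * v k - η k * v i := by
    intro k hk v
    simp [A, Matrix.mulVec, dotProduct, hk, sub_mul, Finset.sum_sub_distrib]
  have hAiv : ∀ v, A.mulVec v i = ∑ j, z j * v j := by
    intro v
    simp [Matrix.mulVec, dotProduct, hAi]
  have hdet : A.det ≠ 0 := by
    intro h0
    obtain ⟨v, hv, hv0⟩ := Matrix.exists_mulVec_eq_zero_iff.mpr h0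
    have h1 : ∀ k, v k = (v i / η i) * η k := by
      intro k
      by_cases hk : k = i
      · subst hk; field_simp
      · have := hAk k hk v
        rw [hv0] at this
        field_simp
        simp only [Pi.zero_apply] at this
        linear_combination -this
    have h2 := hAiv v
    rw [hv0] at h2
    have h3 : ∑ j, z j * v j = (v i / η i) * ∑ j, z j * η j := by
      rw [Finset.mul_sum]
      refine Finset.sum_congr rfl fun j _ => ?_
      rw [h1 j]; ring
    rw [h3] at h2
    have h4 : v i / η i = 0 := by
      rcases mul_eq_zero.mp h2.symm with h | h
      · exact h
      · exact absurd h hc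
    apply hv
    ext k
    rw [h1 k, h4]; simp
  refine ⟨A, (∑ j, z j * η j) / A.det, hAi, fun j => ?_⟩
  have hAη : A.mulVec η = Pi.single i (∑ j, z j * η j) := by
    ext k
    by_cases hk : k = i
    · subst hk; simp [hAiv]
    · rw [hAk k hk]; simp [hk]; ring
  have h5 : (A.adjugate * A).mulVec η j = A.det * η j := by
    rw [Matrix.adjugate_mul]; simp [Matrix.smul_mulVec]
  rw [← Matrix.mulVec_mulVec, hAη, Matrix.mulVec_single] at h5
  simp at h5
  field_simp
  linear_combination h5

theorem huang_lemma_polynomial_power (n ℓ m : ℕ) (hn : 2 ≤ n) (hℓ : ℓ ≤ n) (hm : 1 ≤ m)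
    (φ ψ : Fin (n - 1) → MvPolynomial (Fin n) ℂ)
    (B : MvPolynomial (Fin n ⊕ Fin n) ℂ)
    (heq : (∑ j : Fin (n - 1),
        MvPolynomial.rename Sum.inl (φ j) * MvPolynomial.rename Sum.inr (ψ j)) =
      B * pairingPoly n ℓ ^ m) :
    B = 0 ∧
    (∑ j : Fin (n - 1),
        MvPolynomial.rename Sum.inl (φ j) * MvPolynomial.rename Sum.inr (ψ j)) = 0 := by
  suffices hB : B = 0 by
    refine ⟨hB, ?_⟩
    rw [heq, hB, zero_mul]
  by_contra hB
  obtain ⟨k, rfl⟩ : ∃ k, n = k + 1 := ⟨n - 1, by omega⟩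
  -- the pairing is a nonzero polynomial
  have hpair : pairingPoly (k + 1) ℓ ≠ 0 := by
    intro h0
    have h1 := aeval_pairingPoly (R := ℂ) (k + 1) ℓ (Pi.single 0 1) (Pi.single 0 1)
    rw [h0, map_zero, Fin.sum_univ_succ] at h1
    have h2 := pairSign_sq ℂ ℓ 0
    simp at h1
    rw [← h1] at h2
    simp at h2
  -- a generic point
  obtain ⟨x, hx⟩ : ∃ x : Fin (k + 1) ⊕ Fin (k + 1) → ℂ,
      eval x (B * pairingPoly (k + 1) ℓ ^ m * pairingPoly (k + 1) ℓ *
        ∏ i : Fin (k + 1), X (Sum.inr i)) ≠ 0 := by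
    by_contra! hall
    have h0 : (B * pairingPoly (k + 1) ℓ ^ m * pairingPoly (k + 1) ℓ *
        ∏ i : Fin (k + 1), X (Sum.inr i)) = 0 :=
      MvPolynomial.funext fun x => by rw [hall x, map_zero]
    have h1 : (∏ i : Fin (k + 1), (X (Sum.inr i) : MvPolynomial (Fin (k + 1) ⊕ Fin (k + 1)) ℂ)) ≠ 0 :=
      Finset.prod_ne_zero_iff.mpr fun i _ => X_ne_zero _
    exact mul_ne_zero (mul_ne_zero (mul_ne_zero hB (pow_ne_zero _ hpair)) hpair) h1 h0
  obtain ⟨z, w, rfl⟩ : ∃ z w : Fin (k + 1) → ℂ, x = Sum.elim z w :=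
    ⟨x ∘ Sum.inl, x ∘ Sum.inr, (Sum.elim_comp_inl_inr x).symm⟩
  rw [← coe_aeval_eq_eval] at hx
  simp only [RingHom.coe_coe] at hx
  rw [map_mul, map_mul] at hx
  have hx1 := left_ne_zero_of_mul (left_ne_zero_of_mul hx)
  have hx2 := right_ne_zero_of_mul (left_ne_zero_of_mul hx)
  have hx3 := right_ne_zero_of_mul hx
  rw [aeval_pairingPoly] at hx2
  rw [map_prod, Finset.prod_ne_zero_iff] at hx3
  have hw : ∀ i, w i ≠ 0 := fun i => by simpa using hx3 i (Finset.mem_univ i)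
  -- the generic matrix and a scaling variable
  let R := MvPolynomial (Option (Fin (k + 1) × Fin (k + 1))) ℂ
  let A : Matrix (Fin (k + 1)) (Fin (k + 1)) R := Matrix.of fun i j => X (some (i, j))
  let t : R := X none
  let W : Fin (k + 1) → Fin (k + 1) → R := fun i j => pairSign R ℓ j * (t * A.adjugate j i)
  let G : MvPolynomial (Fin (k + 1) ⊕ Fin (k + 1)) ℂ := B * pairingPoly (k + 1) ℓ ^ m
  let M : Matrix (Fin (k + 1)) (Fin (k + 1)) R :=
    Matrix.of fun i j => aeval (Sum.elim (A i) (W j)) G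
  have hM0 : M.det = 0 := by
    have : M = Matrix.of fun i j : Fin (k + 1) =>
        ∑ a : Fin k, aeval (A i) (φ a) * aeval (W j) (ψ a) := by
      ext1 i j
      simp only [M, G, Matrix.of_apply]
      rw [← heq, map_sum]
      refine Finset.sum_congr rfl fun a _ => ?_
      rw [map_mul, aeval_rename, aeval_rename]
      simp
    rw [this]
    exact det_low_rank k (fun a i => aeval (A i) (φ a)) (fun a j => aeval (W j) (ψ a))
  have hoff : ∀ i j, i ≠ j → M i j = 0 := by
    intro i j hij
    have h1 : aeval (Sum.elim (A i) (W j)) (pairingPoly (k + 1) ℓ) = 0 := by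
      rw [aeval_pairingPoly]
      have h2 : (A * A.adjugate) i j = 0 := by
        rw [Matrix.mul_adjugate]; simp [hij]
      rw [Matrix.mul_apply] at h2
      have h3 : ∑ a : Fin (k + 1), pairSign R ℓ a * A i a * W j a =
          t * ∑ a, A i a * A.adjugate a j := by
        rw [Finset.mul_sum]
        refine Finset.sum_congr rfl fun a _ => ?_
        simp only [W]
        linear_combination (A i a * t * A.adjugate a j) * pairSign_sq R ℓ a
      rw [h3, h2, mul_zero]
    simp only [M, G, Matrix.of_apply]
    rw [map_mul, map_pow, h1, zero_pow (by omega), mul_zero]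
  have hdiag : ∀ i, M i i ≠ 0 := by
    intro i h0
    obtain ⟨A₀, t₀, hA, ht⟩ := exists_dual_matrix (k + 1) i z (fun j => pairSign ℂ ℓ j * w j)
      (mul_ne_zero (left_ne_zero_of_mul_eq_one (pairSign_sq ℂ ℓ i)) (hw i))
      (by
        convert hx2 using 2
        ring)
    let e : R →ₐ[ℂ] ℂ := aeval fun o => Option.elim o t₀ fun p => A₀ p.1 p.2
    have heA : A.map e = A₀ := by
      ext a b; exact aeval_X _ _
    have het : e t = t₀ := aeval_X _ _
    have headj : ∀ a b, e (A.adjugate a b) = A₀.adjugate a b := by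
      intro a b
      have := AlgHom.map_adjugate e A
      rw [AlgHom.mapMatrix_apply, AlgHom.mapMatrix_apply, heA] at this
      rw [← this]; rfl
    have hsign : ∀ j, e (pairSign R ℓ j) = pairSign ℂ ℓ j := by
      intro j; unfold pairSign; split_ifs <;> simp
    apply hx1
    have h1 := congrArg e h0
    simp only [M, Matrix.of_apply, map_zero] at h1
    rw [← AlgHom.comp_apply, comp_aeval] at h1
    rw [← h1]
    congr 2
    funext s
    rcases s with a | a
    · have : e (A i a) = A₀ i a := by rw [← heA]; rfl
      simp [this, hA]
    · simp only [Sum.elim_inr, W]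
      rw [map_mul, map_mul, hsign, het, headj, ht, ← mul_assoc, pairSign_sq, one_mul]
  have hMd : M = Matrix.diagonal fun i => M i i := by
    ext1 i j
    by_cases hij : i = j
    · subst hij; simp
    · rw [hoff i j hij, Matrix.diagonal_apply_ne _ hij]
  rw [hMd, Matrix.det_diagonal] at hM0
  exact Finset.prod_ne_zero_iff.mpr (fun i _ => hdiag i) hM0
end
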